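/- Let G be an SSG, σ a non-optimal MAX strategy, T ⊆ V_MAX with T ∩ S_σ ≠ ∅, and σ' a (σ,T)-super-switch. Then v_{σ'} > v_σ. -/

import Mathlib

open scoped BigOperators

instance : Fact ((0:ℝ) ≤ 1) := ⟨zero_le_one⟩

/-- A simple stochastic game on a finite vertex set `V`. -/
structure SSG (V : Type*) [Fintype V] [DecidableEq V] where
  /-- MAX vertices -/
  VMax : Finset V
  /-- MIN vertices -/
  VMin : Finset V
  /-- random vertices -/
  VR : Finset V
  /-- sink vertices -/
  VS : Finset V
  cover : ∀ x : V, x ∈ VMax ∨ x ∈ VMin ∨ x ∈ VR ∨ x ∈ VS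
  disjMaxMin : Disjoint VMax VMin
  disjMaxR : Disjoint VMax VR
  disjMaxS : Disjoint VMax VS
  disjMinR : Disjoint VMin VR
  disjMinS : Disjoint VMin VS
  disjRS : Disjoint VR VS
  /-- out-neighbourhood: `y ∈ succ x` iff `(x,y)` is an edge -/
  succ : V → Finset V
  outMax : ∀ x ∈ VMax, 2 ≤ (succ x).card
  outMin : ∀ x ∈ VMin, 2 ≤ (succ x).card
  outR : ∀ x ∈ VR, 1 ≤ (succ x).card
  /-- transition probabilities at random vertices -/
  prob : V → V → ℝ
  prob_nonneg : ∀ x y, 0 ≤ prob x y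
  prob_support : ∀ x ∈ VR, ∀ y, y ∉ succ x → prob x y = 0
  prob_sum : ∀ x ∈ VR, (∑ y, prob x y) = 1
  /-- values of the sinks -/
  val : V → ℝ
  val_mem : ∀ x ∈ VS, val x ∈ Set.Icc (0:ℝ) 1

namespace SSG

variable {V : Type*} [Fintype V] [DecidableEq V]

/-- A positional MAX strategy: a choice of an out-neighbour at every MAX vertex
(normalised to the identity away from `VMax`). -/
structure MaxStrategy (G : SSG V) where
  toFun : V → V
  mem_succ : ∀ x ∈ G.VMax, toFun x ∈ G.succ x
  eq_id : ∀ x ∉ G.VMax, toFun x = x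

/-- A positional MIN strategy. -/
structure MinStrategy (G : SSG V) where
  toFun : V → V
  mem_succ : ∀ x ∈ G.VMin, toFun x ∈ G.succ x
  eq_id : ∀ x ∉ G.VMin, toFun x = x

/-- The one-step (monotone) operator on value vectors associated with `(σ,τ)`. -/
noncomputable def F (G : SSG V) (σ : G.MaxStrategy) (τ : G.MinStrategy)
    (w : V → unitInterval) (x : V) : unitInterval :=
  if _hM : x ∈ G.VMax then w (σ.toFun x)
  else if _hN : x ∈ G.VMin then w (τ.toFun x)
  else if hR : x ∈ G.VR then
    ⟨∑ y, G.prob x y * (w y : ℝ), by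
      constructor
      · exact Finset.sum_nonneg fun y _ =>
          mul_nonneg (G.prob_nonneg x y) (w y).2.1
      · calc (∑ y, G.prob x y * (w y : ℝ)) ≤ ∑ y, G.prob x y :=
              Finset.sum_le_sum fun y _ =>
                mul_le_of_le_one_right (G.prob_nonneg x y) (w y).2.2
          _ = 1 := G.prob_sum x hR⟩
  else ⟨G.val x, G.val_mem x (by
    rcases G.cover x with h | h | h | h
    · exact absurd h _hM
    · exact absurd h _hN
    · exact absurd h hR
    · exact h)⟩

/-- The value vector `v_{σ,τ}`: the least fixed point (à la Knaster–Tarski) of `F`. -/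
noncomputable def value (G : SSG V) (σ : G.MaxStrategy) (τ : G.MinStrategy) :
    V → unitInterval :=
  sInf {w : V → unitInterval | G.F σ τ w ≤ w}

/-- `τ` is a best response to `σ`. -/
def IsBestResponse (G : SSG V) (σ : G.MaxStrategy) (τ : G.MinStrategy) : Prop :=
  ∀ τ' : G.MinStrategy, G.value σ τ ≤ G.value σ τ'

/-- `σ` is an optimal MAX strategy: `v_σ ≥ v_{σ'}` for every MAX strategy `σ'`
(values being computed against best responses). -/
def IsOptimal (G : SSG V) (σ : G.MaxStrategy) : Prop :=
  ∀ τ : G.MinStrategy, G.IsBestResponse σ τ →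
    ∀ σ' : G.MaxStrategy, ∀ τ' : G.MinStrategy, G.IsBestResponse σ' τ' →
      G.value σ' τ' ≤ G.value σ τ

/-- The switch set `S_σ` of `σ`, computed with a best response `τ` to `σ`. -/
def switchSet (G : SSG V) (σ : G.MaxStrategy) (τ : G.MinStrategy) : Set V :=
  {x | x ∈ G.VMax ∧ ∃ y ∈ G.succ x, G.value σ τ x < G.value σ τ y}

/-- `σ'` is a `σ`-switch (w.r.t. a best response `τ` to `σ`). -/
def IsSwitch (G : SSG V) (σ : G.MaxStrategy) (τ : G.MinStrategy)
    (σ' : G.MaxStrategy) : Prop :=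
  σ' ≠ σ ∧
  (∀ x ∈ G.VMax, x ∉ G.switchSet σ τ → σ'.toFun x = σ.toFun x) ∧
  (∀ x ∈ G.switchSet σ τ, σ'.toFun x ≠ σ.toFun x →
    G.value σ τ x < G.value σ τ (σ'.toFun x))

/-- `σ` agrees with `σ₀` on `T`. -/
def AgreesOn (G : SSG V) (T : Set V) (σ₀ σ : G.MaxStrategy) : Prop :=
  ∀ x ∈ T, σ.toFun x = σ₀.toFun x

/-- `σ` is an optimal MAX strategy of the subgame `G_{|T[σ₀]}`: it agrees with `σ₀` on `T`
and its value vector dominates that of every MAX strategy of `G` agreeing with `σ₀` on `T`. -/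
def IsOptimalOn (G : SSG V) (T : Set V) (σ₀ σ : G.MaxStrategy) : Prop :=
  G.AgreesOn T σ₀ σ ∧
  ∀ σ' : G.MaxStrategy, G.AgreesOn T σ₀ σ' →
    ∀ τ τ' : G.MinStrategy, G.IsBestResponse σ τ → G.IsBestResponse σ' τ' →
      G.value σ' τ' ≤ G.value σ τ

/-- `σ'` is a `(σ,T)`-super-switch (w.r.t. a best response `τ` to `σ`): it is obtained from an
intermediate `σ`-switch `σ''` that only switches inside `T`, by taking an optimal strategy of
the subgame `G_{|T[σ'']}`. -/
def IsSuperSwitch (G : SSG V) (σ : G.MaxStrategy) (τ : G.MinStrategy)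
    (T : Set V) (σ' : G.MaxStrategy) : Prop :=
  ∃ σ'' : G.MaxStrategy, G.IsSwitch σ τ σ'' ∧
    (∀ x ∈ G.VMax, x ∉ T → σ''.toFun x = σ.toFun x) ∧
    G.IsOptimalOn T σ'' σ'

/-- A binary SSG: every MAX vertex has outdegree exactly 2. -/
def Binary (G : SSG V) : Prop := ∀ x ∈ G.VMax, (G.succ x).card = 2

/-- `σb` is the total switch `σ̄` of `σ` (in a binary SSG): it switches to the other
out-neighbour exactly on the switch set of `σ`. -/
def IsTotalSwitch (G : SSG V) (σ : G.MaxStrategy) (τ : G.MinStrategy)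
    (σb : G.MaxStrategy) : Prop :=
  (∀ x ∈ G.switchSet σ τ, σb.toFun x ≠ σ.toFun x) ∧
  (∀ x ∈ G.VMax, x ∉ G.switchSet σ τ → σb.toFun x = σ.toFun x)

end SSG

namespace SSG

variable {V : Type*} [Fintype V] [DecidableEq V]

theorem F_mono (G : SSG V) (σ : G.MaxStrategy) (τ : G.MinStrategy) : Monotone (G.F σ τ) := by
  intro w w' h x
  unfold F
  split_ifs
  · exact h _
  · exact h _
  · exact Subtype.mk_le_mk.2 (Finset.sum_le_sum fun y _ =>
      mul_le_mul_of_nonneg_left (h y) (G.prob_nonneg x y))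
  · exact le_rfl

theorem value_le (G : SSG V) (σ : G.MaxStrategy) (τ : G.MinStrategy) {w : V → unitInterval}
    (h : G.F σ τ w ≤ w) : G.value σ τ ≤ w := sInf_le h

theorem F_value (G : SSG V) (σ : G.MaxStrategy) (τ : G.MinStrategy) :
    G.F σ τ (G.value σ τ) = G.value σ τ :=
  OrderHom.map_lfp (⟨G.F σ τ, G.F_mono σ τ⟩ : (V → unitInterval) →o (V → unitInterval))

theorem F_max (G : SSG V) (σ : G.MaxStrategy) (τ : G.MinStrategy) (w : V → unitInterval) {x : V}
    (hx : x ∈ G.VMax) : G.F σ τ w x = w (σ.toFun x) := by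
  simp [F, hx]

theorem F_min (G : SSG V) (σ : G.MaxStrategy) (τ : G.MinStrategy) (w : V → unitInterval) {x : V}
    (hx : x ∈ G.VMin) : G.F σ τ w x = w (τ.toFun x) := by
  have : x ∉ G.VMax := fun h => Finset.disjoint_left.1 G.disjMaxMin h hx
  simp [F, hx, this]

theorem F_rand (G : SSG V) (σ : G.MaxStrategy) (τ : G.MinStrategy) (w : V → unitInterval) {x : V}
    (hx : x ∈ G.VR) : (G.F σ τ w x : ℝ) = ∑ y, G.prob x y * (w y : ℝ) := by
  have h1 : x ∉ G.VMax := fun h => Finset.disjoint_left.1 G.disjMaxR h hx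
  have h2 : x ∉ G.VMin := fun h => Finset.disjoint_left.1 G.disjMinR h hx
  simp [F, hx, h1, h2]

theorem F_sink (G : SSG V) (σ : G.MaxStrategy) (τ : G.MinStrategy) (w : V → unitInterval) {x : V}
    (hx : x ∈ G.VS) : (G.F σ τ w x : ℝ) = G.val x := by
  have h1 : x ∉ G.VMax := fun h => Finset.disjoint_left.1 G.disjMaxS h hx
  have h2 : x ∉ G.VMin := fun h => Finset.disjoint_left.1 G.disjMinS h hx
  have h3 : x ∉ G.VR := fun h => Finset.disjoint_left.1 G.disjRS h hx
  simp [F, h1, h2, h3]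

/-- Away from MIN vertices the operator does not depend on the MIN strategy. -/
theorem F_indep (G : SSG V) (σ : G.MaxStrategy) (τ τ' : G.MinStrategy) (w : V → unitInterval)
    {x : V} (hx : x ∉ G.VMin) : G.F σ τ w x = G.F σ τ' w x := by
  simp [F, hx]

/-- The operator in which MIN plays greedily. -/
noncomputable def H (G : SSG V) (σ : G.MaxStrategy) (τ : G.MinStrategy)
    (w : V → unitInterval) (x : V) : unitInterval :=
  if x ∈ G.VMin then (G.succ x).inf w else G.F σ τ w x

theorem H_mono (G : SSG V) (σ : G.MaxStrategy) (τ : G.MinStrategy) : Monotone (G.H σ τ) := by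
  intro w w' h x
  unfold H
  split_ifs
  · exact Finset.inf_mono_fun fun y _ => h y
  · exact G.F_mono σ τ h x

theorem H_le (G : SSG V) (σ : G.MaxStrategy) (τ τ' : G.MinStrategy) (w : V → unitInterval) :
    G.H σ τ w ≤ G.F σ τ' w := by
  intro x
  by_cases hx : x ∈ G.VMin
  · rw [F_min G σ τ' w hx]
    simp only [H, hx, if_true]
    exact Finset.inf_le (τ'.mem_succ x hx)
  · simp only [H, hx, if_false]
    exact (F_indep G σ τ τ' w hx).le

theorem exists_greedy (G : SSG V) (σ : G.MaxStrategy) (τ : G.MinStrategy)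
    (w : V → unitInterval) : ∃ τ' : G.MinStrategy, G.F σ τ' w = G.H σ τ w := by
  have h : ∀ x : V, ∃ y, (x ∈ G.VMin → y ∈ G.succ x ∧ (G.succ x).inf w = w y) ∧
      (x ∉ G.VMin → y = x) := by
    intro x
    by_cases hx : x ∈ G.VMin
    · have hne : (G.succ x).Nonempty := Finset.card_pos.1 (by have := G.outMin x hx; omega)
      obtain ⟨y, hy, e⟩ := Finset.exists_mem_eq_inf _ hne w
      exact ⟨y, fun _ => ⟨hy, e⟩, fun h => absurd hx h⟩
    · exact ⟨x, fun h => absurd h hx, fun _ => rfl⟩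
  choose f hf hf' using h
  refine ⟨⟨f, fun x hx => (hf x hx).1, hf'⟩, ?_⟩
  funext x
  by_cases hx : x ∈ G.VMin
  · rw [F_min G σ _ w hx]
    simp only [H, hx, if_true]
    exact (hf x hx).2.symm
  · simp only [H, hx, if_false]
    exact F_indep G σ _ τ w hx

/-- There is a best response, whose value is a fixed point of the greedy operator. -/
theorem exists_best (G : SSG V) (σ : G.MaxStrategy) (τ : G.MinStrategy) :
    ∃ τ' : G.MinStrategy, G.IsBestResponse σ τ' ∧
      G.H σ τ (G.value σ τ') = G.value σ τ' := by
  let h : (V → unitInterval) →o (V → unitInterval) := ⟨G.H σ τ, G.H_mono σ τ⟩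
  let u := OrderHom.lfp h
  have hu : G.H σ τ u = u := OrderHom.map_lfp h
  obtain ⟨τ', e⟩ := G.exists_greedy σ τ u
  have h1 : G.value σ τ' ≤ u := G.value_le σ τ' (e.trans hu).le
  have h2 : ∀ τ₂ : G.MinStrategy, u ≤ G.value σ τ₂ := fun τ₂ =>
    OrderHom.lfp_le h ((G.H_le σ τ τ₂ _).trans (G.F_value σ τ₂).le)
  have h3 : G.value σ τ' = u := le_antisymm h1 (h2 τ')
  exact ⟨τ', fun τ₂ => h1.trans (h2 τ₂), by rw [h3, hu]⟩

theorem value_le_of_min (G : SSG V) (σ : G.MaxStrategy) (τ : G.MinStrategy)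
    (hbr : G.IsBestResponse σ τ) (τ' : G.MinStrategy) :
    G.value σ τ ≤ G.F σ τ' (G.value σ τ) := by
  obtain ⟨τ₂, hb, e⟩ := G.exists_best σ τ
  have : G.value σ τ = G.value σ τ₂ := le_antisymm (hbr τ₂) (hb τ)
  rw [this]
  exact e.ge.trans (G.H_le σ τ τ' _)

/-- If `v ≤ F w`-style improvement holds and improvement is strict wherever the strategy
changes, the value does not decrease. -/
theorem switch_le (G : SSG V) (σ ρ : G.MaxStrategy) (τ τ' : G.MinStrategy)
    (hbr : G.IsBestResponse σ τ) (hsw : G.IsSwitch σ τ ρ) :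
    G.value σ τ ≤ G.value ρ τ' := by
  set v := G.value σ τ with hv
  set w := G.value ρ τ' with hw
  have hvF : v ≤ G.F σ τ' v := G.value_le_of_min σ τ hbr τ'
  have hwF : G.F ρ τ' w = w := G.F_value ρ τ'
  have hmax : ∀ x ∈ G.VMax, ρ.toFun x = σ.toFun x ∨ v x < v (ρ.toFun x) := by
    intro x hx
    by_cases hs : x ∈ G.switchSet σ τ
    · by_cases e : ρ.toFun x = σ.toFun x
      · exact Or.inl e
      · exact Or.inr (hsw.2.2 x hs e)
    · exact Or.inl (hsw.2.1 x hx hs)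
  by_contra hcon
  obtain ⟨x₀, hx₀⟩ : ∃ x, w x < v x := by
    by_contra! h
    exact hcon h
  obtain ⟨m, -, hm⟩ := Finset.exists_max_image Finset.univ (fun x => (v x : ℝ) - w x)
    ⟨x₀, Finset.mem_univ _⟩
  have hm' : ∀ x, (v x : ℝ) - w x ≤ v m - w m := fun x => hm x (Finset.mem_univ _)
  have hpos : (0:ℝ) < v m - w m := by
    have h1 : (w x₀ : ℝ) < v x₀ := hx₀
    have := hm' x₀
    linarith
  let z : V → unitInterval := fun x => if (v x : ℝ) - w x = v m - w m then 0 else 1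
  have hz : ∀ x, (v x : ℝ) - w x = v m - w m → z x = 0 := fun x h => by simp [z, h]
  have key : G.F σ τ' z ≤ z := by
    intro x
    by_cases hA : (v x : ℝ) - w x = v m - w m
    swap
    · have : z x = 1 := by simp [z, hA]
      rw [this]
      exact unitInterval.le_one'
    rw [hz x hA]
    apply le_of_eq
    have hvx : (v x : ℝ) ≤ G.F σ τ' v x := hvF x
    have hwx : (G.F ρ τ' w x : ℝ) = w x := by rw [hwF]
    rcases G.cover x with hx | hx | hx | hx
    · rw [F_max _ _ _ _ hx] at hvx hwx ⊢
      have h1 := hm' (ρ.toFun x)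
      rcases hmax x hx with e | e
      · rw [e] at hwx h1
        exact hz _ (by linarith)
      · have e' : (v x : ℝ) < v (ρ.toFun x) := e
        linarith
    · rw [F_min _ _ _ _ hx] at hvx hwx ⊢
      have h1 := hm' (τ'.toFun x)
      exact hz _ (by linarith)
    · rw [F_rand _ _ _ _ hx] at hvx hwx
      apply Subtype.ext
      rw [F_rand _ _ _ _ hx]
      have hnn : ∀ y ∈ Finset.univ, 0 ≤ G.prob x y * ((v m - w m) - ((v y : ℝ) - w y)) :=
        fun y _ => mul_nonneg (G.prob_nonneg x y) (by linarith [hm' y])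
      have hsum : ∑ y, G.prob x y * (((v m : ℝ) - w m) - ((v y : ℝ) - w y)) = 
          (v m - w m) - (∑ y, G.prob x y * (v y : ℝ) - ∑ y, G.prob x y * (w y : ℝ)) := by
        simp only [mul_sub, Finset.sum_sub_distrib, ← Finset.sum_mul, G.prob_sum x hx]
        ring
      have h0 := le_antisymm (by linarith) (Finset.sum_nonneg hnn)
      rw [Finset.sum_eq_zero_iff_of_nonneg hnn] at h0
      change _ = (0:ℝ)
      apply Finset.sum_eq_zero
      intro y hy
      rcases mul_eq_zero.1 (h0 y hy) with h | h
      · simp [h]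
      · rw [hz y (by linarith)]
        simp
    · rw [F_sink _ _ _ _ hx] at hvx hwx
      linarith
  have h1 : (v m : ℝ) ≤ z m := ((hbr τ').trans (G.value_le σ τ' key)) m
  rw [hz m rfl] at h1
  have h2 : (0:ℝ) ≤ w m := (w m).2.1
  have h3 : (v m : ℝ) ≤ 0 := h1
  linarith

theorem switch_lt (G : SSG V) (σ ρ : G.MaxStrategy) (τ τ' : G.MinStrategy)
    (hbr : G.IsBestResponse σ τ) (hsw : G.IsSwitch σ τ ρ) :
    G.value σ τ < G.value ρ τ' := by
  have hle := G.switch_le σ ρ τ τ' hbr hsw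
  obtain ⟨x, hx⟩ : ∃ x, ρ.toFun x ≠ σ.toFun x := by
    by_contra! h
    apply hsw.1
    cases ρ
    cases σ
    congr
    exact funext h
  have hM : x ∈ G.VMax := by
    by_contra h
    exact hx ((ρ.eq_id x h).trans (σ.eq_id x h).symm)
  have hS : x ∈ G.switchSet σ τ := by
    by_contra h
    exact hx (hsw.2.1 x hM h)
  have h1 := hsw.2.2 x hS hx
  have h2 : G.value ρ τ' x = G.value ρ τ' (ρ.toFun x) := by
    conv_lhs => rw [← F_value]
    exact F_max _ _ _ _ hM
  refine Pi.lt_def.2 ⟨hle, x, ?_⟩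
  rw [h2]
  exact h1.trans_le (hle _)

end SSG

/-- a `(σ,T)`-super-switch of a non-optimal strategy `σ` strictly improves
its value: `v_{σ'} > v_σ`. -/
theorem superSwitch_improves {V : Type*} [Fintype V] [DecidableEq V] (G : SSG V)
    (σ σ' : G.MaxStrategy) (τ τ' : G.MinStrategy)
    (hbr : G.IsBestResponse σ τ) (hbr' : G.IsBestResponse σ' τ')
    (hnopt : ¬ G.IsOptimal σ) (T : Set V) (hT : T ⊆ ↑G.VMax)
    (hTS : (T ∩ G.switchSet σ τ).Nonempty)
    (hss : G.IsSuperSwitch σ τ T σ') :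
    G.value σ τ < G.value σ' τ' := by
  obtain ⟨ρ, hsw, -, -, hopt⟩ := hss
  obtain ⟨τ₂, hb, -⟩ := G.exists_best ρ τ
  exact (G.switch_lt σ ρ τ τ₂ hbr hsw).trans_le
    (hopt ρ (fun _ _ => rfl) τ' τ₂ hbr' hb)
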